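/- Let x_{n,1} denote the indicator random variable of the event that vertex 1 belongs to class 1 and is isolated in G(n; μ, K_n, P_n, α_n). Consider a scaling such that Λ_1(n) = c_n · (log n)/n for every n, where c_n → c and 0 < c < 1. Then n · E[x_{n,1}] → ∞ as n → ∞. -/

import Mathlib

open Filter Real

noncomputable section

namespace HetKey

/-- The set of ordered index pairs `x < y` (one Bernoulli coin per unordered pair). -/
abbrev Pairs (n : ℕ) : Type := {p : Fin n × Fin n // p.1 < p.2}

/-- A configuration of the randomness: the class of each vertex, the key ring of each
vertex (a subset of the key pool `{1,…,P}`), and the Bernoulli link coins. -/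
abbrev Config (n r P : ℕ) : Type :=
  (Fin n → Fin r) × (Fin n → Finset (Fin P)) × (Pairs n → Bool)

/-- Weight of a key ring under the uniform distribution on `k`-subsets of the pool. -/
def keyWeight (P k : ℕ) (s : Finset (Fin P)) : ℝ :=
  if s.card = k then ((P.choose k : ℝ))⁻¹ else 0

/-- Probability weight of a configuration: classes are i.i.d. with law `μ`, key rings are
(conditionally) uniform `K (class)`-subsets, link coins are i.i.d. Bernoulli(`α`). -/
def weight {n r P : ℕ} (μ : Fin r → ℝ) (K : Fin r → ℕ) (α : ℝ)
    (cfg : Config n r P) : ℝ :=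
  (∏ x, μ (cfg.1 x) * keyWeight P (K (cfg.1 x)) (cfg.2.1 x)) *
    ∏ p, (if cfg.2.2 p then α else 1 - α)

open scoped Classical in
/-- Probability of an event in `G(n; μ, K, P, α)`. -/
def Pr {n r P : ℕ} (μ : Fin r → ℝ) (K : Fin r → ℕ) (α : ℝ)
    (E : Config n r P → Prop) : ℝ :=
  ∑ cfg, if E cfg then weight μ K α cfg else 0

/-- Expectation of a random variable on the configuration space. -/
def expect {n r P : ℕ} (μ : Fin r → ℝ) (K : Fin r → ℕ) (α : ℝ)
    (X : Config n r P → ℝ) : ℝ :=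
  ∑ cfg, weight μ K α cfg * X cfg

/-- The Bernoulli coin attached to the unordered pair `{x, y}`. -/
def coin {n : ℕ} (b : Pairs n → Bool) (x y : Fin n) : Bool :=
  if h : x < y then b ⟨(x, y), h⟩
  else if h' : y < x then b ⟨(y, x), h'⟩
  else false

/-- Adjacency in `G(n; μ, K, P, α)`: distinct vertices, intersecting key rings, and an
operational (non-failed) link. -/
def adj {n r P : ℕ} (cfg : Config n r P) (x y : Fin n) : Prop :=
  x ≠ y ∧ (cfg.2.1 x ∩ cfg.2.1 y).Nonempty ∧ coin cfg.2.2 x y = true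

/-- A vertex is isolated if it has no neighbours. -/
def isolated {n r P : ℕ} (cfg : Config n r P) (x : Fin n) : Prop :=
  ∀ y, ¬ adj cfg x y

/-- Connectivity: every pair of vertices is joined by a path. -/
def conn {n r P : ℕ} (cfg : Config n r P) : Prop :=
  ∀ x y : Fin n, Relation.ReflTransGen (adj cfg) x y

/-- `p_{ij}`: the probability that a uniform `K_i`-subset and an independent uniform
`K_j`-subset of a pool of size `P` intersect. -/
def pEdge (P Ki Kj : ℕ) : ℝ :=
  1 - ((P - Ki).choose Kj : ℝ) / (P.choose Kj : ℝ)

/-- `λ_i = Σ_j μ_j p_{ij}`. -/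
def lam {r : ℕ} (μ : Fin r → ℝ) (K : Fin r → ℕ) (P : ℕ) (i : Fin r) : ℝ :=
  ∑ j, μ j * pEdge P (K i) (K j)

/-- `Λ_i = α λ_i`. -/
def Lam {r : ℕ} (μ : Fin r → ℝ) (K : Fin r → ℕ) (P : ℕ) (α : ℝ) (i : Fin r) : ℝ :=
  α * lam μ K P i

end HetKey

open HetKey

/-- The weights of the key rings of size `k` sum to one. -/
lemma sum_keyWeight {P k : ℕ} (hk : k ≤ P) : ∑ s, keyWeight P k s = 1 := by
  have hP : (P.choose k : ℝ) ≠ 0 := by exact_mod_cast (Nat.choose_pos hk).ne'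
  simp only [keyWeight, ← Finset.sum_filter, Finset.sum_const, Finset.univ_filter_card_eq,
    Finset.card_powersetCard, Finset.card_univ, Fintype.card_fin, nsmul_eq_mul]
  exact mul_inv_cancel₀ hP

/-- The probability that a uniform `k`-subset avoids a given set `s₀`. -/
lemma sum_keyWeight_of_disjoint {P k : ℕ} (s₀ : Finset (Fin P)) :
    ∑ s, keyWeight P k s * (if (s₀ ∩ s).Nonempty then 0 else 1) =
      ((P - s₀.card).choose k : ℝ) / (P.choose k : ℝ) := by
  have hfilter : ({s | s.card = k ∧ ¬ (s₀ ∩ s).Nonempty} : Finset (Finset (Fin P))) =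
      s₀ᶜ.powersetCard k := by
    ext s
    rw [Finset.mem_filter, Finset.mem_powersetCard, Finset.not_nonempty_iff_eq_empty,
      ← Finset.disjoint_iff_inter_eq_empty, Finset.subset_compl_iff_disjoint_left]
    simp [and_comm]
  have hterm : ∀ s : Finset (Fin P),
      keyWeight P k s * (if (s₀ ∩ s).Nonempty then 0 else 1) =
        if s.card = k ∧ ¬ (s₀ ∩ s).Nonempty then ((P.choose k : ℝ))⁻¹ else 0 := by
    intro s
    unfold keyWeight
    split_ifs <;> simp_all
  rw [Finset.sum_congr rfl fun s _ => hterm s, ← Finset.sum_filter, hfilter,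
    Finset.sum_const, Finset.card_powersetCard, Finset.card_compl, Fintype.card_fin,
    nsmul_eq_mul, div_eq_mul_inv]

/-- The probability that a vertex with key ring `s₀` of class `i` is not adjacent to another
given vertex. -/
lemma sum_not_adj {r P : ℕ} {μ : Fin r → ℝ} (hμ : ∑ i, μ i = 1) {K : Fin r → ℕ}
    (hK : ∀ j, K j ≤ P) (α : ℝ) (i : Fin r) {s₀ : Finset (Fin P)} (hs₀ : s₀.card = K i) :
    ∑ j, ∑ s, μ j * keyWeight P (K j) s * (if (s₀ ∩ s).Nonempty then 1 - α else 1) =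
      1 - Lam μ K P α i := by
  have hinner : ∀ j,
      ∑ s, μ j * keyWeight P (K j) s * (if (s₀ ∩ s).Nonempty then 1 - α else 1) =
        μ j - α * (μ j * pEdge P (K i) (K j)) := by
    intro j
    have hterm : ∀ s : Finset (Fin P),
        μ j * keyWeight P (K j) s * (if (s₀ ∩ s).Nonempty then 1 - α else 1) =
          μ j * (1 - α) * keyWeight P (K j) s +
            μ j * α * (keyWeight P (K j) s * (if (s₀ ∩ s).Nonempty then 0 else 1)) := by
      intro s
      split_ifs <;> ring
    rw [Finset.sum_congr rfl fun s _ => hterm s, Finset.sum_add_distrib, ← Finset.mul_sum,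
      ← Finset.mul_sum, sum_keyWeight (hK j), sum_keyWeight_of_disjoint, hs₀, pEdge]
    ring
  rw [Finset.sum_congr rfl fun j _ => hinner j, Finset.sum_sub_distrib, hμ, Lam, lam,
    Finset.mul_sum]

/-- A product over pairs that only involves the pairs containing the least vertex. -/
lemma prod_pairs_zero {m : ℕ} (g : Fin (m + 1) → ℝ) :
    ∏ p : Pairs (m + 1), (if p.1.1 = 0 then g p.1.2 else 1) = ∏ y : Fin m, g y.succ := by
  symm
  refine Finset.prod_of_injOn (fun y => ⟨(0, y.succ), y.succ_pos⟩) ?_ ?_ ?_ ?_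
  · intro a _ b _ h
    simpa using h
  · intro _ _
    simp
  · rintro ⟨⟨a, b⟩, hab⟩ - hp
    rw [if_neg]
    intro ha
    have ha : a = 0 := ha
    subst ha
    obtain ⟨y, rfl⟩ := Fin.exists_succ_eq.2 (Fin.pos_iff_ne_zero.1 hab)
    exact hp ⟨y, by simp, rfl⟩
  · intro _ _
    simp

/-- Isolation of the least vertex in terms of the coins of the pairs containing it. -/
lemma isolated_zero_iff {m r P : ℕ} (cfg : Config (m + 1) r P) :
    isolated cfg 0 ↔
      ∀ p : Pairs (m + 1),
        ¬ (p.1.1 = 0 ∧ (cfg.2.1 0 ∩ cfg.2.1 p.1.2).Nonempty ∧ cfg.2.2 p = true) := by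
  constructor
  · rintro h ⟨⟨a, b⟩, hab⟩ ⟨ha, hne, hb⟩
    have ha : a = 0 := ha
    subst ha
    have hlt : (0 : Fin (m + 1)) < b := hab
    exact h b ⟨hlt.ne, hne, by rw [coin, dif_pos hlt]; exact hb⟩
  · rintro h y ⟨hy, hne, hb⟩
    have hlt : 0 < y := Fin.pos_iff_ne_zero.2 hy.symm
    rw [coin, dif_pos hlt] at hb
    exact h ⟨(0, y), hlt⟩ ⟨rfl, hne, hb⟩

open scoped Classical in
/-- Averaging the isolation indicator of the least vertex over the coins. -/
lemma sum_coins_isolated_zero {m r P : ℕ} (α : ℝ) (t : Fin (m + 1) → Fin r)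
    (S : Fin (m + 1) → Finset (Fin P)) :
    ∑ b : Pairs (m + 1) → Bool, (∏ p, (if b p then α else 1 - α)) *
        (if isolated (t, S, b) 0 then 1 else 0) =
      ∏ y : Fin m, (if (S 0 ∩ S y.succ).Nonempty then 1 - α else 1) := by
  have hind : ∀ b : Pairs (m + 1) → Bool,
      (∏ p, (if b p then α else 1 - α)) * (if isolated (t, S, b) 0 then 1 else 0) =
        ∏ p : Pairs (m + 1), (if b p then α else 1 - α) *
          (if ¬ (p.1.1 = 0 ∧ (S 0 ∩ S p.1.2).Nonempty ∧ b p = true) then 1 else 0) := by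
    intro b
    rw [Finset.prod_mul_distrib, Finset.prod_ite_zero]
    simp [isolated_zero_iff]
  rw [Finset.sum_congr rfl fun b _ => hind b,
    ← prod_pairs_zero fun y => if (S 0 ∩ S y).Nonempty then 1 - α else 1]
  rw [← Fintype.prod_sum fun (p : Pairs (m + 1)) (c : Bool) => (if c then α else 1 - α) *
    (if ¬ (p.1.1 = 0 ∧ (S 0 ∩ S p.1.2).Nonempty ∧ c = true) then (1 : ℝ) else 0)]
  refine Finset.prod_congr rfl fun p _ => ?_
  rw [Fintype.sum_bool]
  by_cases h0 : p.1.1 = 0 <;> by_cases hne : (S 0 ∩ S p.1.2).Nonempty <;> simp [h0, hne]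

open scoped Classical in
/-- The probability that the least vertex has class `i` and is isolated. -/
lemma expect_class_isolated_zero {m r P : ℕ} {μ : Fin r → ℝ} (hμ : ∑ i, μ i = 1)
    {K : Fin r → ℕ} (hK : ∀ j, K j ≤ P) (α : ℝ) (i : Fin r) :
    expect (n := m + 1) (P := P) μ K α
        (fun cfg => if cfg.1 0 = i ∧ isolated cfg 0 then 1 else 0) =
      μ i * (1 - Lam μ K P α i) ^ m := by
  have hcoins : expect (n := m + 1) (P := P) μ K α
        (fun cfg => if cfg.1 0 = i ∧ isolated cfg 0 then 1 else 0) =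
      ∑ t : Fin (m + 1) → Fin r, ∑ S : Fin (m + 1) → Finset (Fin P),
        (if t 0 = i then μ (t 0) * keyWeight P (K (t 0)) (S 0) else 0) *
          ∏ y : Fin m, (μ (t y.succ) * keyWeight P (K (t y.succ)) (S y.succ) *
            (if (S 0 ∩ S y.succ).Nonempty then 1 - α else 1)) := by
    rw [expect, Fintype.sum_prod_type]
    refine Finset.sum_congr rfl fun t _ => ?_
    rw [Fintype.sum_prod_type]
    refine Finset.sum_congr rfl fun S _ => ?_
    rw [Finset.prod_mul_distrib, ← sum_coins_isolated_zero α t S, Finset.mul_sum,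
      Finset.mul_sum]
    refine Finset.sum_congr rfl fun b _ => ?_
    simp only [weight, Fin.prod_univ_succ, ite_and]
    split_ifs <;> ring
  have hrest : ∀ s₀ : Finset (Fin P), s₀.card = K i →
      ∑ t : Fin m → Fin r, ∑ S : Fin m → Finset (Fin P),
        ∏ y : Fin m, (μ (t y) * keyWeight P (K (t y)) (S y) *
            (if (s₀ ∩ S y).Nonempty then 1 - α else 1)) = (1 - Lam μ K P α i) ^ m := by
    intro s₀ hs₀
    have hS : ∀ t : Fin m → Fin r, ∑ S : Fin m → Finset (Fin P),
        ∏ y : Fin m, (μ (t y) * keyWeight P (K (t y)) (S y) *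
            (if (s₀ ∩ S y).Nonempty then 1 - α else 1)) =
        ∏ y : Fin m, ∑ s, (μ (t y) * keyWeight P (K (t y)) s *
            (if (s₀ ∩ s).Nonempty then 1 - α else 1)) := fun t =>
      (Fintype.prod_sum fun (y : Fin m) s => μ (t y) * keyWeight P (K (t y)) s *
            (if (s₀ ∩ s).Nonempty then 1 - α else 1)).symm
    rw [Finset.sum_congr rfl fun t _ => hS t,
      ← Fintype.prod_sum fun (_ : Fin m) j => ∑ s, (μ j * keyWeight P (K j) s *
            (if (s₀ ∩ s).Nonempty then 1 - α else 1)),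
      Finset.prod_congr rfl fun _ _ => sum_not_adj hμ hK α i hs₀]
    simp
  rw [hcoins, ← (Fin.consEquiv fun _ => Fin r).sum_comp, Fintype.sum_prod_type]
  have hclass : ∀ j : Fin r, ∑ t : Fin m → Fin r, ∑ S : Fin (m + 1) → Finset (Fin P),
      (if j = i then μ j * keyWeight P (K j) (S 0) else 0) *
          ∏ y : Fin m, (μ (t y) * keyWeight P (K (t y)) (S y.succ) *
            (if (S 0 ∩ S y.succ).Nonempty then 1 - α else 1)) =
      if j = i then μ i * (1 - Lam μ K P α i) ^ m else 0 := by
    intro j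
    split_ifs with hj
    · subst hj
      simp_rw [← (Fin.consEquiv fun _ => Finset (Fin P)).sum_comp, Fintype.sum_prod_type]
      rw [Finset.sum_comm]
      simp only [Fin.consEquiv_apply, Fin.cons_zero, Fin.cons_succ, ← Finset.mul_sum]
      have hring : ∀ s₀ : Finset (Fin P), μ j * keyWeight P (K j) s₀ *
          ∑ t : Fin m → Fin r, ∑ S : Fin m → Finset (Fin P),
            ∏ y : Fin m, (μ (t y) * keyWeight P (K (t y)) (S y) *
              (if (s₀ ∩ S y).Nonempty then 1 - α else 1)) =
          μ j * (1 - Lam μ K P α j) ^ m * keyWeight P (K j) s₀ := by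
        intro s₀
        by_cases hs₀ : s₀.card = K j
        · rw [hrest s₀ hs₀]
          ring
        · simp [keyWeight, hs₀]
      rw [Finset.sum_congr rfl fun s₀ _ => hring s₀, ← Finset.mul_sum, sum_keyWeight (hK j),
        mul_one]
    · simp
  simp only [Fin.consEquiv_apply, Fin.cons_zero, Fin.cons_succ]
  rw [Finset.sum_congr rfl fun j _ => hclass j]
  simp

/-- If `c_n → c < 1` then `n (1 - c_n log n / n)^(n-1) → ∞`. -/
lemma tendsto_mul_one_sub_log_div_pow {u : ℕ → ℝ} {c : ℝ} (hu : Tendsto u atTop (nhds c))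
    (hc0 : 0 < c) (hc1 : c < 1) :
    Tendsto (fun n : ℕ => (n : ℝ) * (1 - u n * Real.log n / n) ^ (n - 1)) atTop atTop := by
  have hL : Tendsto (fun n : ℕ => u n * Real.log n / n) atTop (nhds 0) := by
    have hlog : Tendsto (fun n : ℕ => Real.log n / n) atTop (nhds 0) :=
      Real.isLittleO_log_id_atTop.tendsto_div_nhds_zero.comp tendsto_natCast_atTop_atTop
    simpa [mul_div_assoc] using hu.mul hlog
  have hratio : Tendsto (fun n : ℕ => u n / (1 - u n * Real.log n / n)) atTop (nhds c) := by
    simpa [Pi.div_def] using hu.div (hL.const_sub 1) (by norm_num)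
  obtain ⟨d, hcd, hd1⟩ := exists_between hc1
  have hpow : Tendsto (fun n : ℕ => (n : ℝ) ^ (1 - d)) atTop atTop :=
    (tendsto_rpow_atTop (sub_pos.2 hd1)).comp tendsto_natCast_atTop_atTop
  refine tendsto_atTop_mono' _ ?_ hpow
  filter_upwards [hratio.eventually_lt_const hcd, hL.eventually_lt_const one_pos,
    hu.eventually_const_lt hc0, eventually_ge_atTop 2] with n hrn hLn hun hn
  set L := u n * Real.log n / n with hLdef
  have hn0 : (0 : ℝ) < n := by positivity
  have hlog : 0 ≤ Real.log n := Real.log_natCast_nonneg n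
  have hL0 : 0 ≤ L := by positivity
  have hpos : 0 < 1 - L := sub_pos.2 hLn
  have hbase : Real.exp (-(L / (1 - L))) ≤ 1 - L := by
    rw [Real.exp_neg]
    refine inv_le_of_inv_le₀ hpos ?_
    have := Real.add_one_le_exp (L / (1 - L))
    have heq : (1 - L)⁻¹ = L / (1 - L) + 1 := by
      field_simp
      ring
    rwa [heq]
  have hexp : -(d * Real.log n) ≤ ((n - 1 : ℕ) : ℝ) * -(L / (1 - L)) := by
    have h1 : ((n - 1 : ℕ) : ℝ) * (L / (1 - L)) ≤ n * (L / (1 - L)) :=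
      mul_le_mul_of_nonneg_right (by exact_mod_cast n.sub_le 1) (by positivity)
    have h2 : n * (L / (1 - L)) = u n / (1 - L) * Real.log n := by
      rw [hLdef]
      field_simp
    have h3 := mul_le_mul_of_nonneg_right hrn.le hlog
    linarith
  calc (n : ℝ) ^ (1 - d) = n * Real.exp (-(d * Real.log n)) := by
        rw [Real.rpow_def_of_pos hn0, mul_sub, mul_one, sub_eq_add_neg, Real.exp_add,
          Real.exp_log hn0, mul_comm d]
    _ ≤ n * Real.exp (((n - 1 : ℕ) : ℝ) * -(L / (1 - L))) := by gcongr
    _ = n * Real.exp (-(L / (1 - L))) ^ (n - 1) := by rw [Real.exp_nat_mul]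
    _ ≤ n * (1 - L) ^ (n - 1) := by gcongr

open scoped Classical in
/-- with `x_{n,1}` the indicator that vertex 1 is of class 1 and isolated
in `G(n; μ, K_n, P_n, α_n)`, if `Λ_1(n) = c_n log n / n` with `c_n → c` and `0 < c < 1`,
then `n ⬝ E[x_{n,1}] → ∞`. -/
theorem mean_class_one_isolated_tendsto_atTop
    (r : ℕ) (hr : 0 < r)
    (μ : Fin r → ℝ) (hμpos : ∀ i, 0 < μ i) (hμsum : ∑ i, μ i = 1)
    (K : ℕ → Fin r → ℕ) (Pn : ℕ → ℕ) (α : ℕ → ℝ)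
    (hα0 : ∀ n, 0 < α n) (hα1 : ∀ n, α n < 1)
    (hK1 : ∀ n i, 1 ≤ K n i)
    (hKmono : ∀ n, Monotone (K n))
    (hKP : ∀ n i, 2 * K n i ≤ Pn n)
    (cn : ℕ → ℝ) (c : ℝ)
    (hcn : Tendsto cn atTop (nhds c)) (hc0 : 0 < c) (hc1 : c < 1)
    (hΛ : ∀ n, 2 ≤ n →
      Lam μ (K n) (Pn n) (α n) ⟨0, hr⟩ = cn n * Real.log n / n) :
    Tendsto
      (fun n : ℕ =>
        if hn : 2 ≤ n then
          (n : ℝ) * expect (n := n) (P := Pn n) μ (K n) (α n)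
            (fun cfg =>
              if cfg.1 ⟨0, by omega⟩ = ⟨0, hr⟩ ∧ isolated cfg ⟨0, by omega⟩
              then 1 else 0)
        else 0)
      atTop atTop := by
  have hmain := (tendsto_mul_one_sub_log_div_pow hcn hc0 hc1).const_mul_atTop (hμpos ⟨0, hr⟩)
  refine hmain.congr' ?_
  filter_upwards [eventually_ge_atTop 2] with n hn
  rw [dif_pos hn, ← hΛ n hn]
  obtain ⟨m, rfl⟩ : ∃ m, n = m + 1 := ⟨n - 1, by omega⟩
  have hE := expect_class_isolated_zero (m := m) hμsum
    (fun j => by have := hKP (m + 1) j; omega : ∀ j, K (m + 1) j ≤ Pn (m + 1))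
    (α (m + 1)) ⟨0, hr⟩
  rw [Nat.add_sub_cancel, mul_left_comm, ← hE]
  rfl
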